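/- Let B ⊆ A be linear subspaces of ℝ^d with dim B = b ≥ 1 and dim A = a, b ≤ a ≤ d and b < d. Let ψ, φ : [1,∞) → (0,∞) be decreasing functions with ψ(T) ≤ 1 for all T, and suppose dist(z, B) ≥ ψ(|z|) for every nonzero z ∈ ℤ^d. Then there is a constant κ > 0 depending only on d such that for every T ≥ 2, the number of z ∈ ℤ^d with T/2 < |z| ≤ T and dist(z, A) ≤ φ(|z|) is at most κ·μ_{T/2}, where μ_S = (S/ψ(S))^{a−b} · max{1, (φ(S)/ψ(S))^{d−a}}. -/

import Mathlib

open MeasureTheory Filter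

noncomputable section

/-- The sup-norm of a vector in Euclidean space. -/
def supNorm {d : ℕ} (w : EuclideanSpace ℝ (Fin d)) : ℝ := ⨆ i, |w i|

/-- The point of `ℝ^d` (with Euclidean metric) corresponding to an integer vector. -/
def intVec {d : ℕ} (z : Fin d → ℤ) : EuclideanSpace ℝ (Fin d) :=
  (WithLp.equiv 2 (Fin d → ℝ)).symm (fun i => (z i : ℝ))

/-- The irrationality measure function `ψ_B` of a linear subspace of `ℝ^d`:
`ψ_B(t) = inf { dist(z, B) : z ∈ ℤ^d, 1 ≤ |z| < t }`. -/
def psiSub {d : ℕ} (B : Submodule ℝ (EuclideanSpace ℝ (Fin d))) (t : ℝ) : ℝ :=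
  sInf ((fun z : Fin d → ℤ =>
      Metric.infDist (intVec z) (B : Set (EuclideanSpace ℝ (Fin d)))) ''
    {z | 1 ≤ supNorm (intVec z) ∧ supNorm (intVec z) < t})

/-- The Diophantine exponent of a linear subspace of `ℝ^d`:
`ω(B) = sup { γ : liminf_{t→∞} t^γ ψ_B(t) < ∞ }`, as an extended real number. -/
def diophExp {d : ℕ} (B : Submodule ℝ (EuclideanSpace ℝ (Fin d))) : EReal :=
  sSup {x : EReal | ∃ γ : ℝ, x = (γ : EReal) ∧
    Filter.liminf (fun t : ℝ => ENNReal.ofReal (t ^ γ * psiSub B t)) Filter.atTop < ⊤}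

/-- The graph subspace `C(Θ)` of an `(a-c)×c` matrix `Θ`, relative to an orthonormal
basis `e` of an `a`-dimensional subspace of `ℝ^d`:
`C(Θ) = { ∑ x_j e_j + ∑_i (∑_j θ_{ij} x_j) e_{c+i} : x ∈ ℝ^c }`. -/
def graphSub (d a c : ℕ) (hca : c ≤ a) (e : Fin a → EuclideanSpace ℝ (Fin d))
    (Θ : Fin (a - c) → Fin c → ℝ) : Submodule ℝ (EuclideanSpace ℝ (Fin d)) :=
  Submodule.span ℝ {v | ∃ x : Fin c → ℝ,
    v = (∑ j : Fin c, x j • e (Fin.castLE hca j)) +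
        ∑ i : Fin (a - c), (∑ j : Fin c, Θ i j * x j) • e ⟨c + i.1, by have := i.2; omega⟩}

/-- `μ_T = (T/ψ(T))^{a−b} · max{1, (φ(T)/ψ(T))^{d−a}}` for `T ≥ 1`, and `μ_T = 0` for `T < 1`. -/
def muF (a b d : ℕ) (ψ φ : ℝ → ℝ) (T : ℝ) : ℝ :=
  if T < 1 then 0 else (T / ψ T) ^ (a - b) * max 1 ((φ T / ψ T) ^ (d - a))

/-- `M_T = Σ_{j=0}^{⌊log₂ T⌋} μ_{T/2^j}` for integers `T ≥ 1` (and `M_0 = 0`). -/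
def MF (a b d : ℕ) (ψ φ : ℝ → ℝ) (T : ℕ) : ℝ :=
  ∑ j ∈ Finset.range (Nat.log 2 T + 1), muF a b d ψ φ ((T : ℝ) / 2 ^ j)

/-- `λ_T = M_T − M_{T−1}` for integers `T ≥ 1`. -/
def lamF (a b d : ℕ) (ψ φ : ℝ → ℝ) (T : ℕ) : ℝ :=
  MF a b d ψ φ T - MF a b d ψ φ (T - 1)

/-- A subspace of dimension `n` has `n` unit vectors whose coordinate functionals bound the norm of
the orthogonal projection. -/
theorem exists_unit_vectors_norm_starProjection_le {E : Type*} [NormedAddCommGroup E]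
    [InnerProductSpace ℝ E] [FiniteDimensional ℝ E] (C : Submodule ℝ E) {n : ℕ}
    (hn : Module.finrank ℝ C = n) :
    ∃ u : Fin n → E, (∀ i, u i ∈ C) ∧ (∀ i, ‖u i‖ = 1) ∧
      ∀ x, ‖C.starProjection x‖ ≤ ∑ i, |inner ℝ (u i) x| := by
  subst hn
  let e := stdOrthonormalBasis ℝ C
  refine ⟨fun i => e i, fun i => (e i).2, fun i => e.norm_eq_one i, fun x => ?_⟩
  rw [Submodule.starProjection_apply, e.orthogonalProjectionOnto_apply_eq_sum, Submodule.coe_sum]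
  refine (norm_sum_le _ _).trans (Finset.sum_le_sum fun i _ => ?_)
  have h : ‖(e i : E)‖ = 1 := e.norm_eq_one i
  simp [norm_smul, h]

/-- The distance to `B` is controlled by the components in `Aᗮ` and in `Bᗮ ⊓ A`. -/
theorem infDist_le_norm_starProjection_add {E : Type*} [NormedAddCommGroup E]
    [InnerProductSpace ℝ E] [FiniteDimensional ℝ E] {A B : Submodule ℝ E} (hBA : B ≤ A) (x : E) :
    Metric.infDist x (B : Set E) ≤
      ‖(Bᗮ ⊓ A).starProjection x‖ + ‖Aᗮ.starProjection x‖ := by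
  have hA : Aᗮ.starProjection x = x - A.starProjection x := by simp
  have hxA : x - A.starProjection x ∈ Aᗮ := Submodule.sub_starProjection_mem_orthogonal x
  have hxB : x - B.starProjection x ∈ Bᗮ := Submodule.sub_starProjection_mem_orthogonal x
  have hPB : B.starProjection x ∈ B := Submodule.starProjection_apply_mem B x
  have hPA : A.starProjection x ∈ A := Submodule.starProjection_apply_mem A x
  have hC : (Bᗮ ⊓ A).starProjection x = A.starProjection x - B.starProjection x := by
    refine Submodule.eq_starProjection_of_mem_orthogonal' (z :=
      (x - A.starProjection x) + B.starProjection x) ⟨?_, ?_⟩ ?_ (by abel)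
    · have := Bᗮ.sub_mem hxB (Submodule.orthogonal_le hBA hxA)
      rwa [sub_sub_sub_cancel_left] at this
    · exact A.sub_mem hPA (hBA hPB)
    · refine Submodule.add_mem _ (Submodule.orthogonal_le inf_le_right hxA) ?_
      exact Submodule.orthogonal_le inf_le_left (B.le_orthogonal_orthogonal hPB)
  rw [hA, hC]
  calc Metric.infDist x (B : Set E) ≤ dist x (B.starProjection x) :=
        Metric.infDist_le_dist_of_mem hPB
    _ = ‖(A.starProjection x - B.starProjection x) + (x - A.starProjection x)‖ := by
        rw [dist_eq_norm]; congr 1; abel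
    _ ≤ _ := norm_add_le _ _

/-- A unit vector orthogonal to `A` detects at most the distance to `A`. -/
theorem abs_inner_le_infDist {E : Type*} [NormedAddCommGroup E] [InnerProductSpace ℝ E]
    {A : Submodule ℝ E} {u : E} (hu : u ∈ Aᗮ) (hu1 : ‖u‖ = 1) (x : E) :
    |inner ℝ u x| ≤ Metric.infDist x (A : Set E) := by
  refine (Metric.le_infDist ⟨0, A.zero_mem⟩).2 fun y hy => ?_
  have h : inner ℝ u x = inner ℝ u (x - y) := by
    rw [inner_sub_right, Submodule.inner_left_of_mem_orthogonal hy hu, sub_zero]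
  rw [h, dist_eq_norm]
  simpa [hu1] using abs_real_inner_le_norm u (x - y)

theorem floor_mem_Icc_of_abs_le {y M : ℝ} (h : |y| ≤ M) :
    ⌊y⌋ ∈ Finset.Icc ⌊-M⌋ ⌊M⌋ :=
  Finset.mem_Icc.2 ⟨Int.floor_mono (abs_le.1 h).1, Int.floor_mono (abs_le.1 h).2⟩

theorem card_Icc_floor_le {M : ℝ} (hM : 0 ≤ M) :
    ((Finset.Icc ⌊-M⌋ ⌊M⌋).card : ℝ) ≤ 2 * M + 2 := by
  have h0 : ⌊-M⌋ ≤ ⌊M⌋ := Int.floor_mono (by linarith)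
  have h1 : ((⌊M⌋ + 1 - ⌊-M⌋).toNat : ℤ) = ⌊M⌋ + 1 - ⌊-M⌋ := Int.toNat_of_nonneg (by omega)
  have h2 : ((⌊M⌋ + 1 - ⌊-M⌋).toNat : ℝ) = ⌊M⌋ + 1 - ⌊-M⌋ := by exact_mod_cast h1
  rw [Int.card_Icc, h2]
  linarith [Int.floor_le M, Int.lt_floor_add_one (-M)]

theorem abs_sub_lt_of_floor_div_eq {x y r : ℝ} (hr : 0 < r) (h : ⌊x / r⌋ = ⌊y / r⌋) :
    |x - y| < r := by
  have := Int.abs_sub_lt_one_of_floor_eq_floor h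
  rwa [← sub_div, abs_div, abs_of_pos hr, div_lt_one hr] at this

theorem abs_le_supNorm {d : ℕ} (w : EuclideanSpace ℝ (Fin d)) (i : Fin d) : |w i| ≤ supNorm w :=
  le_ciSup (f := fun i => |w i|) (Set.finite_range _).bddAbove i

theorem supNorm_le {d : ℕ} {w : EuclideanSpace ℝ (Fin d)} {r : ℝ} (hr : 0 ≤ r)
    (h : ∀ i, |w i| ≤ r) : supNorm w ≤ r :=
  Real.iSup_le h hr

theorem norm_le_card_mul_supNorm {d : ℕ} (w : EuclideanSpace ℝ (Fin d)) :
    ‖w‖ ≤ d * supNorm w := by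
  have h := (EuclideanSpace.basisFun (Fin d) ℝ).sum_repr w
  calc ‖w‖ = ‖∑ i, w i • EuclideanSpace.basisFun (Fin d) ℝ i‖ := by
        conv_lhs => rw [← h]
        simp
    _ ≤ ∑ i, ‖w i • EuclideanSpace.basisFun (Fin d) ℝ i‖ := norm_sum_le _ _
    _ ≤ ∑ _i : Fin d, supNorm w := by
        refine Finset.sum_le_sum fun i _ => ?_
        simpa [norm_smul] using abs_le_supNorm w i
    _ = d * supNorm w := by simp

@[simp]
theorem intVec_apply {d : ℕ} (z : Fin d → ℤ) (i : Fin d) : intVec z i = z i := rfl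

theorem intVec_sub {d : ℕ} (z w : Fin d → ℤ) : intVec (z - w) = intVec z - intVec w := by
  ext i
  simp

theorem one_le_supNorm_intVec {d : ℕ} {z : Fin d → ℤ} (hz : z ≠ 0) : 1 ≤ supNorm (intVec z) := by
  obtain ⟨i, hi⟩ := Function.ne_iff.1 hz
  refine le_trans ?_ (abs_le_supNorm _ i)
  rw [intVec_apply, ← Int.cast_abs]
  exact_mod_cast Int.one_le_abs hi

/-- Grid index of `z`: its cube of side `S`, and the cells of side `δ` containing its coordinates
along `u` and `v`. -/
def gridIndex {d m n : ℕ} (u : Fin m → EuclideanSpace ℝ (Fin d))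
    (v : Fin n → EuclideanSpace ℝ (Fin d)) (S δ : ℝ) (z : Fin d → ℤ) :
    (Fin d → ℤ) × (Fin m → ℤ) × (Fin n → ℤ) :=
  (fun i => ⌊(z i : ℝ) / S⌋, fun i => ⌊inner ℝ (u i) (intVec z) / δ⌋,
    fun i => ⌊inner ℝ (v i) (intVec z) / δ⌋)

/-- If the coordinates along `u` and `v` control the distance to `B`, then integer points within
one grid cell coincide. -/
theorem gridIndex_injective {d m n : ℕ} {B : Submodule ℝ (EuclideanSpace ℝ (Fin d))}
    {u : Fin m → EuclideanSpace ℝ (Fin d)} {v : Fin n → EuclideanSpace ℝ (Fin d)} {S δ ρ : ℝ}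
    (hS : 0 < S) (hδ : 0 < δ) (hρ : (m + n) * δ < ρ)
    (huv : ∀ x, Metric.infDist x (B : Set (EuclideanSpace ℝ (Fin d))) ≤
      (∑ i, |inner ℝ (u i) x|) + ∑ i, |inner ℝ (v i) x|)
    (hB : ∀ z : Fin d → ℤ, z ≠ 0 → supNorm (intVec z) ≤ S →
      ρ ≤ Metric.infDist (intVec z) (B : Set (EuclideanSpace ℝ (Fin d)))) :
    Function.Injective (gridIndex u v S δ) := by
  intro z w hzw
  simp only [gridIndex, Prod.mk.injEq, funext_iff] at hzw
  obtain ⟨h1, h2, h3⟩ := hzw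
  by_contra hne
  have hle : supNorm (intVec (z - w)) ≤ S := supNorm_le hS.le fun i => by
    simpa using (abs_sub_lt_of_floor_div_eq hS (h1 i)).le
  have hcoord : ∀ f : EuclideanSpace ℝ (Fin d),
      ⌊inner ℝ f (intVec z) / δ⌋ = ⌊inner ℝ f (intVec w) / δ⌋ →
      |inner ℝ f (intVec (z - w))| ≤ δ := fun f hf => by
    rw [intVec_sub, inner_sub_right]
    exact (abs_sub_lt_of_floor_div_eq hδ hf).le
  have hsum := huv (intVec (z - w))
  have hu := Finset.sum_le_card_nsmul Finset.univ
    (fun i => |inner ℝ (u i) (intVec (z - w))|) δ fun i _ => hcoord _ (h2 i)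
  have hv := Finset.sum_le_card_nsmul Finset.univ
    (fun i => |inner ℝ (v i) (intVec (z - w))|) δ fun i _ => hcoord _ (h3 i)
  simp only [Finset.card_univ, Fintype.card_fin, nsmul_eq_mul] at hu hv
  linarith [hB (z - w) (sub_ne_zero.2 hne) hle]

/-- Counting integer points through their grid indices. -/
theorem finite_and_ncard_le_of_gridIndex {d m n : ℕ} {u : Fin m → EuclideanSpace ℝ (Fin d)}
    {v : Fin n → EuclideanSpace ℝ (Fin d)} {S δ P Q : ℝ} (hS : 0 < S) (hδ : 0 < δ)
    (hP : 0 ≤ P) (hQ : 0 ≤ Q) (hinj : Function.Injective (gridIndex u v S δ))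
    {Z : Set (Fin d → ℤ)} (hZ : ∀ z ∈ Z, supNorm (intVec z) ≤ 2 * S)
    (hZu : ∀ z ∈ Z, ∀ i, |inner ℝ (u i) (intVec z)| ≤ P)
    (hZv : ∀ z ∈ Z, ∀ i, |inner ℝ (v i) (intVec z)| ≤ Q) :
    Z.Finite ∧ (Z.ncard : ℝ) ≤
      6 ^ d * (2 * (P / δ) + 2) ^ m * (2 * (Q / δ) + 2) ^ n := by
  let F : Finset ((Fin d → ℤ) × (Fin m → ℤ) × (Fin n → ℤ)) :=
    Fintype.piFinset (fun _ => Finset.Icc ⌊-(2 : ℝ)⌋ ⌊(2 : ℝ)⌋) ×ˢ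
      Fintype.piFinset (fun _ => Finset.Icc ⌊-(P / δ)⌋ ⌊P / δ⌋) ×ˢ
      Fintype.piFinset (fun _ => Finset.Icc ⌊-(Q / δ)⌋ ⌊Q / δ⌋)
  have hmaps : Set.MapsTo (gridIndex u v S δ) Z F := fun z hz => by
    have hdiv : ∀ {y M r : ℝ}, 0 < r → |y| ≤ M → |y / r| ≤ M / r := fun hr h => by
      rw [abs_div, abs_of_pos hr]
      gcongr
    simp only [F, gridIndex, Finset.mem_coe, Finset.mem_product, Fintype.mem_piFinset]
    refine ⟨fun i => floor_mem_Icc_of_abs_le ?_,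
      fun i => floor_mem_Icc_of_abs_le (hdiv hδ (hZu z hz i)),
      fun i => floor_mem_Icc_of_abs_le (hdiv hδ (hZv z hz i))⟩
    have := hdiv hS ((abs_le_supNorm (intVec z) i).trans (hZ z hz))
    rwa [mul_div_cancel_right₀ _ hS.ne'] at this
  refine ⟨Set.Finite.of_injOn hmaps hinj.injOn F.finite_toSet, ?_⟩
  have hcard : Z.ncard ≤ F.card := by
    simpa using Set.ncard_le_ncard_of_injOn _ hmaps hinj.injOn F.finite_toSet
  have h2 := card_Icc_floor_le (M := 2) (by norm_num)
  have hP' := card_Icc_floor_le (M := P / δ) (by positivity)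
  have hQ' := card_Icc_floor_le (M := Q / δ) (by positivity)
  calc (Z.ncard : ℝ) ≤ F.card := by exact_mod_cast hcard
    _ = ((Finset.Icc ⌊-(2 : ℝ)⌋ ⌊(2 : ℝ)⌋).card : ℝ) ^ d *
        (((Finset.Icc ⌊-(P / δ)⌋ ⌊P / δ⌋).card : ℝ) ^ m *
        ((Finset.Icc ⌊-(Q / δ)⌋ ⌊Q / δ⌋).card : ℝ) ^ n) := by
        simp only [F, Finset.card_product, Fintype.card_piFinset_const]
        push_cast
        rfl
    _ ≤ 6 ^ d * ((2 * (P / δ) + 2) ^ m * (2 * (Q / δ) + 2) ^ n) := by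
        gcongr
        linarith
    _ = _ := by ring

theorem max_one_pow_le {r : ℝ} (n : ℕ) : max 1 r ^ n ≤ max 1 (r ^ n) := by
  rcases le_total 1 r with h | h
  · rw [max_eq_right h]
    exact le_max_right _ _
  · rw [max_eq_left h, one_pow]
    exact le_max_left _ _

/-- there is `κ > 0` depending only on `d` such that for subspaces `B ⊆ A` of
`ℝ^d` with `dim B = b ≥ 1`, `dim A = a`, `b ≤ a ≤ d`, `b < d`, decreasing positive `ψ, φ` with
`ψ ≤ 1` and `B` being `ψ`-badly approximable, and every `T ≥ 2`, the number of `z ∈ ℤ^d` with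
`T/2 < |z| ≤ T` and `dist(z,A) ≤ φ(|z|)` is at most `κ·μ_{T/2}`. -/
theorem stmt_11 (d : ℕ) :
    ∃ κ : ℝ, 0 < κ ∧
      ∀ (a b : ℕ) (B A : Submodule ℝ (EuclideanSpace ℝ (Fin d))) (ψ φ : ℝ → ℝ),
        1 ≤ b → b ≤ a → a ≤ d → b < d → B ≤ A →
        Module.finrank ℝ B = b → Module.finrank ℝ A = a →
        (∀ T : ℝ, 1 ≤ T → 0 < ψ T) → (∀ T : ℝ, 1 ≤ T → 0 < φ T) →
        AntitoneOn ψ (Set.Ici 1) → AntitoneOn φ (Set.Ici 1) →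
        (∀ T : ℝ, 1 ≤ T → ψ T ≤ 1) →
        (∀ z : Fin d → ℤ, z ≠ 0 →
          ψ (supNorm (intVec z)) ≤
            Metric.infDist (intVec z) (B : Set (EuclideanSpace ℝ (Fin d)))) →
        ∀ T : ℝ, 2 ≤ T →
          {z : Fin d → ℤ | T / 2 < supNorm (intVec z) ∧ supNorm (intVec z) ≤ T ∧
              Metric.infDist (intVec z) (A : Set (EuclideanSpace ℝ (Fin d))) ≤
                φ (supNorm (intVec z))}.Finite ∧
          (({z : Fin d → ℤ | T / 2 < supNorm (intVec z) ∧ supNorm (intVec z) ≤ T ∧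
              Metric.infDist (intVec z) (A : Set (EuclideanSpace ℝ (Fin d))) ≤
                φ (supNorm (intVec z))}.ncard : ℝ)) ≤ κ * muF a b d ψ φ (T / 2) := by
  refine ⟨6 ^ d * (4 * d * (d + 1) + 4) ^ d, by positivity, ?_⟩
  intro a b B A ψ φ _ hba had _ hBA hfB hfA hψ hφ hψanti hφanti hψ1 hbad T hT
  set S := T / 2 with hSdef
  have hS1 : 1 ≤ S := by linarith
  have hS0 : 0 < S := by linarith
  have hψS := hψ S hS1
  have hφS := hφ S hS1
  obtain ⟨u, -, hu1, hu⟩ := exists_unit_vectors_norm_starProjection_le (Bᗮ ⊓ A) (n := a - b)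
    (Submodule.finrank_add_inf_finrank_orthogonal' hBA (by omega))
  obtain ⟨v, hvA, hv1, hv⟩ := exists_unit_vectors_norm_starProjection_le Aᗮ (n := d - a)
    (Submodule.finrank_add_finrank_orthogonal' (by rw [finrank_euclideanSpace_fin]; omega))
  have hd1 : (0 : ℝ) < d + 1 := by positivity
  have hδ : 0 < ψ S / (d + 1) := by positivity
  have hinj : Function.Injective (gridIndex u v S (ψ S / (d + 1))) := by
    refine gridIndex_injective (B := B) (ρ := ψ S) hS0 hδ ?_ (fun x => ?_) fun z hz hzS => ?_
    · have hle : ((a - b : ℕ) + (d - a : ℕ) : ℝ) ≤ d := by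
        exact_mod_cast (by omega : (a - b) + (d - a) ≤ d)
      rw [← mul_div_assoc, div_lt_iff₀ hd1]
      nlinarith
    · exact (infDist_le_norm_starProjection_add hBA x).trans (add_le_add (hu x) (hv x))
    · exact (hψanti (one_le_supNorm_intVec hz) hS1 hzS).trans (hbad z hz)
  have key := finite_and_ncard_le_of_gridIndex (P := d * (2 * S)) (Q := φ S) hS0 hδ
    (by positivity) hφS.le hinj
    (Z := {z : Fin d → ℤ | S < supNorm (intVec z) ∧ supNorm (intVec z) ≤ T ∧
      Metric.infDist (intVec z) (A : Set (EuclideanSpace ℝ (Fin d))) ≤ φ (supNorm (intVec z))})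
    (fun z hz => hz.2.1.trans (by linarith))
    (fun z hz i => by
      calc |inner ℝ (u i) (intVec z)| ≤ ‖intVec z‖ := by
            simpa [hu1] using abs_real_inner_le_norm (u i) (intVec z)
        _ ≤ d * supNorm (intVec z) := norm_le_card_mul_supNorm _
        _ ≤ d * (2 * S) := by
            gcongr
            linarith [hz.2.1])
    (fun z hz i => (abs_inner_le_infDist (hvA i) (hv1 i) _).trans
      (hz.2.2.trans (hφanti hS1 (hS1.trans hz.1.le) hz.1.le)))
  refine ⟨key.1, key.2.trans ?_⟩
  rw [muF, if_neg (not_lt.2 hS1)]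
  set K : ℝ := 4 * d * (d + 1) + 4 with hK
  have hK1 : 1 ≤ K := by
    have : (0 : ℝ) ≤ 4 * d * (d + 1) := by positivity
    linarith
  have hratio : 1 ≤ S / ψ S := (one_le_div hψS).2 ((hψ1 S hS1).trans hS1)
  have hU : 2 * (d * (2 * S) / (ψ S / (d + 1))) + 2 ≤ K * (S / ψ S) := by
    have : 2 * (d * (2 * S) / (ψ S / (d + 1))) = 4 * d * (d + 1) * (S / ψ S) := by
      field_simp
      ring
    rw [this, hK, add_mul]
    linarith
  have hV : (2 * (φ S / (ψ S / (d + 1))) + 2) ^ (d - a) ≤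
      (K * max 1 (φ S / ψ S)) ^ (d - a) := by
    rcases Nat.eq_zero_or_pos d with h0 | hpos
    · simp [h0]
    have hd : (1 : ℝ) ≤ d := by exact_mod_cast hpos
    have h1 : 2 * (φ S / (ψ S / (d + 1))) = 2 * (d + 1) * (φ S / ψ S) := by
      field_simp
    refine pow_le_pow_left₀ (by positivity) ?_ _
    rw [h1]
    calc 2 * (d + 1) * (φ S / ψ S) + 2
        ≤ 2 * (d + 1) * max 1 (φ S / ψ S) + 2 * max 1 (φ S / ψ S) := by
          gcongr
          · exact le_max_right _ _
          · linarith [le_max_left 1 (φ S / ψ S)]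
      _ = (2 * (d + 1) + 2) * max 1 (φ S / ψ S) := by ring
      _ ≤ K * max 1 (φ S / ψ S) := by
          gcongr
          rw [hK]
          nlinarith
  calc 6 ^ d * (2 * (d * (2 * S) / (ψ S / (d + 1))) + 2) ^ (a - b) *
        (2 * (φ S / (ψ S / (d + 1))) + 2) ^ (d - a)
      ≤ 6 ^ d * (K * (S / ψ S)) ^ (a - b) * (K * max 1 (φ S / ψ S)) ^ (d - a) := by
        gcongr
    _ = 6 ^ d * K ^ ((a - b) + (d - a)) *
        ((S / ψ S) ^ (a - b) * max 1 (φ S / ψ S) ^ (d - a)) := by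
        rw [mul_pow, mul_pow, pow_add]
        ring
    _ ≤ 6 ^ d * K ^ d * ((S / ψ S) ^ (a - b) * max 1 ((φ S / ψ S) ^ (d - a))) := by
        gcongr
        · omega
        · exact max_one_pow_le _

end
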